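/- Let L_a(t) denote the number of 3×3 magilatin squares with magic sum t. Then for every positive integer t divisible by 840, 280·L_a(t) = 35t⁴ − 840t³ + 10570t² − 73536t + 265440. -/

import Mathlib

/-- `La t` = number of 3×3 magilatin squares (positive entries, all row and
column sums equal, entries distinct within each row and within each column)
with magic sum t. -/
noncomputable def La (t : ℕ) : ℕ :=
  {x : Matrix (Fin 3) (Fin 3) ℤ |
    (∀ i j, 0 < x i j) ∧
    (∀ i, Function.Injective fun j => x i j) ∧
    (∀ j, Function.Injective fun i => x i j) ∧
    (∀ i, ∑ j, x i j = (t : ℤ)) ∧ (∀ j, ∑ i, x i j = (t : ℤ))}.ncard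

open scoped ENNReal

namespace Magi

/-- weighted sum over all strictly positive combinations of the columns in a list -/
noncomputable def S {M : Type} [AddCommMonoid M] : List M → (M → ℝ≥0∞) → ℝ≥0∞
  | [], φ => φ 0
  | x :: L, φ => ∑' n : ℕ, S L (fun m => φ ((n+1) • x + m))

variable {M : Type} [AddCommMonoid M]

def Pos : List M → M → Prop
  | [], m => m = 0
  | x :: L, m => ∃ n : ℕ, ∃ m', Pos L m' ∧ m = (n+1) • x + m'

theorem S_congr (L : List M) : ∀ (φ ψ : M → ℝ≥0∞), (∀ m, Pos L m → φ m = ψ m) → S L φ = S L ψ := by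
  induction L with
  | nil => intro φ ψ h; exact h 0 rfl
  | cons x L ih =>
    intro φ ψ h
    simp only [S]
    refine tsum_congr fun n => ih _ _ fun m hm => h _ ⟨n, m, hm, rfl⟩

theorem S_zero (L : List M) : S L (fun _ => 0) = 0 := by
  induction L with
  | nil => rfl
  | cons x L ih => simp [S, ih]

theorem S_perm {L L' : List M} (h : L.Perm L') : ∀ φ : M → ℝ≥0∞, S L φ = S L' φ := by
  induction h with
  | nil => intro φ; rfl
  | cons x _ ih => intro φ; simp only [S]; exact tsum_congr fun n => ih _
  | swap x y L =>
    intro φ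
    simp only [S]
    rw [ENNReal.tsum_comm]
    refine tsum_congr fun n => tsum_congr fun k => ?_
    congr 1; funext m; congr 1; abel
  | trans _ _ ih1 ih2 => intro φ; rw [ih1, ih2]

theorem tsum_split (g : ℕ → ℕ → ℝ≥0∞) :
    ∑' n, ∑' m, g n m = ∑' k, ∑' m, g (k + 1 + m) m + ∑' m, g m m + ∑' k, ∑' m, g m (k + 1 + m) := by
  have key : ∀ n m, g n m = (if m < n then g n m else 0) + (if n = m then g n m else 0)
      + (if n < m then g n m else 0) := by
    intro n m
    rcases lt_trichotomy n m with h | h | h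
    · simp [h, h.ne, not_lt.mpr h.le]
    · simp [h]
    · simp [h, h.ne', not_lt.mpr h.le]
  have tri : ∀ f : ℕ → ℕ → ℝ≥0∞, ∑' m, ∑' n, (if m < n then f n m else 0)
      = ∑' k, ∑' m, f (k+1+m) m := by
    intro f
    rw [ENNReal.tsum_comm (f := fun k m => f (k+1+m) m)]
    refine tsum_congr fun m => ?_
    have inj : Function.Injective (fun k : ℕ => k + 1 + m) := fun a b h => by
      simp only at h; omega
    rw [← inj.tsum_eq (f := fun n => if m < n then f n m else 0)]
    · refine tsum_congr fun k => ?_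
      rw [if_pos (by omega)]
    · intro n hn
      simp only [Function.mem_support, ne_eq, ite_eq_right_iff, Classical.not_imp] at hn
      exact ⟨n - m - 1, by simp only; omega⟩
  have diag : ∀ n, ∑' m, (if n = m then g n m else 0) = g n n := by
    intro n
    rw [tsum_eq_single n]
    · simp
    · intro b hb; simp [hb.symm]
  calc ∑' n, ∑' m, g n m = ∑' n, ∑' m, ((if m < n then g n m else 0) + (if n = m then g n m else 0)
      + (if n < m then g n m else 0)) := tsum_congr fun n => tsum_congr fun m => key n m
    _ = _ := by
      simp only [ENNReal.tsum_add]
      simp only [diag]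
      rw [tri (fun n m => g m n), ENNReal.tsum_comm (f := fun n m => if m < n then g n m else 0), tri g]

theorem S_split (x y : M) (L : List M) (φ : M → ℝ≥0∞) :
    S (x :: y :: L) φ = S (x :: (x+y) :: L) φ + S ((x+y) :: L) φ + S (y :: (x+y) :: L) φ := by
  simp only [S]
  rw [tsum_split]
  congr 1
  · congr 1
    · refine tsum_congr fun k => tsum_congr fun m => ?_
      congr 1; funext z; congr 1
      rw [show k + 1 + m + 1 = (k+1) + (m+1) by ring, add_nsmul _ (k+1), nsmul_add]; abel
    · refine tsum_congr fun m => ?_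
      congr 1; funext z; congr 1
      rw [nsmul_add]; abel
  · refine tsum_congr fun k => tsum_congr fun m => ?_
    congr 1; funext z; congr 1
    rw [show k + 1 + m + 1 = (k+1) + (m+1) by ring, add_nsmul _ (k+1), nsmul_add]; abel

theorem S_map {N : Type} [AddCommMonoid N] (W : M →+ N) (L : List M) :
    ∀ ψ : N → ℝ≥0∞, S L (fun m => ψ (W m)) = S (L.map W) ψ := by
  induction L with
  | nil => intro ψ; simp [S]
  | cons x L ih =>
    intro ψ
    simp only [S, List.map_cons]
    refine tsum_congr fun n => ?_
    rw [← ih]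
    simp

theorem Pos_le (p q : M →+ ℕ) (L : List M) (h : ∀ x ∈ L, p x ≤ q x) :
    ∀ m, Pos L m → p m ≤ q m := by
  induction L with
  | nil => intro m hm; rw [show m = 0 from hm]; simp
  | cons x L ih =>
    rintro m ⟨n, m', hm', rfl⟩
    simp only [map_add, map_nsmul, smul_eq_mul]
    have h1 := h x (by simp)
    have h2 := ih (fun y hy => h y (by simp [hy])) m' hm'
    gcongr

theorem Pos_lt (p q : M →+ ℕ) (L : List M) (h : ∀ x ∈ L, p x ≤ q x) (h' : ∃ x ∈ L, p x < q x) :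
    ∀ m, Pos L m → p m < q m := by
  induction L with
  | nil => simp at h'
  | cons x L ih =>
    rintro m ⟨n, m', hm', rfl⟩
    simp only [map_add, map_nsmul, smul_eq_mul]
    have h1 := h x (by simp)
    have h2 := Pos_le p q L (fun y hy => h y (by simp [hy])) m' hm'
    obtain ⟨y, hy, hlt⟩ := h'
    rcases List.mem_cons.mp hy with rfl | hy
    · have : (n+1) * p y < (n+1) * q y := by gcongr
      omega
    · have h3 := ih (fun y hy => h y (by simp [hy])) ⟨y, hy, hlt⟩ m' hm'
      have : (n+1) * p x ≤ (n+1) * q x := by gcongr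
      omega

/-! denumerants -/

def d : List ℕ → ℕ → ℕ
  | [], t => if t = 0 then 1 else 0
  | w :: ws, t => if w ≤ t ∧ 0 < w then d (w :: ws) (t - w) + d ws (t - w) else 0
termination_by ws t => (ws.length, t)
decreasing_by
  · right; omega
  · left; simp

theorem d_add (w : ℕ) (hw : 0 < w) (ws : List ℕ) (t : ℕ) :
    d (w :: ws) (t + w) = d (w :: ws) t + d ws t := by
  rw [d, if_pos ⟨by omega, hw⟩]; simp

theorem d_lt (w : ℕ) (ws : List ℕ) (t : ℕ) (h : t < w) : d (w :: ws) t = 0 := by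
  rw [d, if_neg (by omega)]

theorem S_eq_d (ws : List ℕ) (h : ∀ w ∈ ws, 0 < w) :
    ∀ t, S ws (fun m => if m = t then 1 else 0) = (d ws t : ℝ≥0∞) := by
  induction ws with
  | nil => intro t; simp [S, d, eq_comm]
  | cons w ws ih =>
    have hw := h w (by simp)
    have ih := ih (fun y hy => h y (by simp [hy]))
    intro t
    induction t using Nat.strong_induction_on with
    | _ t iht =>
      rcases lt_or_ge t w with hlt | hge
      · rw [d_lt _ _ _ hlt]
        simp only [S, smul_eq_mul]
        simp only [Nat.cast_zero, ENNReal.tsum_eq_zero]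
        intro n
        refine Eq.trans ?_ (S_zero ws)
        congr 1; funext m
        rw [if_neg]
        nlinarith
      · obtain ⟨s, rfl⟩ := Nat.exists_eq_add_of_le' hge
        rw [d_add w hw, Nat.cast_add, ← iht s (by omega), ← ih s]
        simp only [S, smul_eq_mul]
        rw [tsum_eq_zero_add' ENNReal.summable, add_comm]
        congr 1
        · refine tsum_congr fun n => ?_
          congr 1; funext m
          congr 1
          apply propext
          constructor <;> intro h <;> nlinarith
        · congr 1; funext m
          congr 1
          apply propext
          constructor <;> intro h <;> omega


/-! differences -/

def Q : ℕ → (ℕ → ℤ) → Prop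
  | 0, f => ∀ t, 1 ≤ t → f t = 0
  | r+1, f => Q r (fun t => f (t + 840) - f t)

theorem Q_zero (r : ℕ) : Q r (fun _ => 0) := by
  induction r with
  | zero => intro t _; rfl
  | succ r ih => simpa [Q] using ih

theorem Q_add (r : ℕ) : ∀ f g : ℕ → ℤ, Q r f → Q r g → Q r (fun t => f t + g t) := by
  induction r with
  | zero => intro f g hf hg t ht; simp [hf t ht, hg t ht]
  | succ r ih =>
    intro f g hf hg
    have := ih _ _ hf hg
    simp only [Q]
    convert this using 2
    ring

theorem Q_mul (r : ℕ) (c : ℤ) : ∀ f : ℕ → ℤ, Q r f → Q r (fun t => c * f t) := by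
  induction r with
  | zero => intro f hf t ht; simp [hf t ht]
  | succ r ih =>
    intro f hf
    have := ih _ hf
    simp only [Q]
    convert this using 2
    ring

theorem Q_shift (r : ℕ) (a : ℕ) : ∀ f : ℕ → ℤ, Q r f → Q r (fun t => f (t + a)) := by
  induction r with
  | zero => intro f hf t ht; exact hf _ (by omega)
  | succ r ih =>
    intro f hf
    have := ih _ hf
    simp only [Q]
    convert this using 4
    ring

theorem Q_succ (r : ℕ) (f : ℕ → ℤ) (h : Q r f) : Q (r+1) f := by
  have := Q_add r _ _ (Q_shift r 840 f h) (Q_mul r (-1) f h)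
  simp only [Q]
  convert this using 2
  ring

theorem Q_le {r r' : ℕ} (hr : r ≤ r') (f : ℕ → ℤ) (h : Q r f) : Q r' f := by
  induction hr with
  | refl => exact h
  | step _ ih => exact Q_succ _ _ ih

theorem Q_sum (r : ℕ) (f : ℕ → ℤ) (h : Q r f) (w K : ℕ) :
    Q r (fun t => ∑ j ∈ Finset.range K, f (t + j * w)) := by
  induction K with
  | zero => simpa using Q_zero r
  | succ K ih =>
    have := Q_add r _ _ ih (Q_shift r (K * w) f h)
    convert this using 2
    rw [Finset.sum_range_succ]

theorem Q_d (ws : List ℕ) (h : ∀ w ∈ ws, w ∣ 840) : Q ws.length (fun t => (d ws t : ℤ)) := by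
  induction ws with
  | nil =>
    intro t ht
    simp [d]; omega
  | cons w ws ih =>
    have ih := ih (fun y hy => h y (by simp [hy]))
    obtain ⟨K, hK⟩ := h w (by simp)
    have hw : 0 < w := by
      rcases Nat.eq_zero_or_pos w with h | h
      · simp [h] at hK
      · exact h
    have key : ∀ K t, (d (w :: ws) (t + K * w) : ℤ) - d (w :: ws) t
        = ∑ j ∈ Finset.range K, (d ws (t + j * w) : ℤ) := by
      intro K t
      induction K with
      | zero => simp
      | succ K ih2 =>
        rw [Finset.sum_range_succ, ← ih2, show t + (K+1) * w = (t + K * w) + w by ring, d_add w hw]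
        push_cast; ring
    have := Q_sum _ _ ih w K
    simp only [List.length_cons, Q]
    convert this using 2 with t
    rw [← key, hK, mul_comm w K]

/-! evaluation through one large number -/

def X : ℕ := 2 ^ 80
def NN : ℕ := 4201

def G (w : ℕ) : ℕ := X ^ w * (((X ^ w) ^ (NN / w + 1) - 1) / (X ^ w - 1))

noncomputable def enc (N : ℕ) (f : ℕ → ℕ) : ℕ := ∑ t ∈ Finset.range N, f t * X ^ t

theorem enc_mod (N w : ℕ) (f : ℕ → ℕ) : enc (N + w) f ≡ enc N f [MOD X ^ N] := by
  have : enc (N + w) f = enc N f + X ^ N * ∑ t ∈ Finset.range w, f (N + t) * X ^ t := by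
    unfold enc
    rw [Finset.sum_range_add, Finset.mul_sum]
    congr 1
    refine Finset.sum_congr rfl fun t _ => ?_
    rw [pow_add]; ring
  rw [this]
  simp [Nat.ModEq]

theorem enc_step (N w : ℕ) (hw : 0 < w) (ws : List ℕ) :
    enc (N + w) (d (w :: ws)) = X ^ w * (enc N (d (w :: ws)) + enc N (d ws)) := by
  unfold enc
  rw [add_comm N w, Finset.sum_range_add, ← Finset.sum_add_distrib, Finset.mul_sum]
  rw [Finset.sum_eq_zero, zero_add]
  · refine Finset.sum_congr rfl fun t _ => ?_
    rw [add_comm w t, d_add w hw, pow_add]; ring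
  · intro t ht
    rw [d_lt _ _ _ (Finset.mem_range.mp ht), zero_mul]

theorem enc_G (w : ℕ) (hw : 0 < w) (ws : List ℕ) :
    enc NN (d (w :: ws)) ≡ enc NN (d ws) * G w [MOD X ^ NN] := by
  set E' := enc NN (d (w :: ws))
  set E := enc NN (d ws)
  have h1 : E' ≡ X ^ w * (E' + E) [MOD X ^ NN] := by
    rw [← enc_step NN w hw ws]; exact (enc_mod NN w _).symm
  have h2 : ∀ K, E' ≡ E * (X ^ w * ∑ j ∈ Finset.range K, (X ^ w) ^ j) + (X ^ w) ^ K * E'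
      [MOD X ^ NN] := by
    intro K
    induction K with
    | zero => simp; rfl
    | succ K ih =>
      refine ih.trans ?_
      have h3 := (Nat.ModEq.mul_left ((X ^ w) ^ K) h1).add_left
        (E * (X ^ w * ∑ j ∈ Finset.range K, (X ^ w) ^ j))
      refine h3.trans ?_
      rw [Finset.sum_range_succ]
      have e : ∀ a b : ℕ, a = b → a ≡ b [MOD X ^ NN] := fun a b h => h ▸ Nat.ModEq.refl a
      apply e
      ring
  have h3 := h2 (NN / w + 1)
  rw [Nat.geomSum_eq] at h3
  · refine h3.trans ?_
    have hd : X ^ NN ∣ (X ^ w) ^ (NN / w + 1) := by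
      rw [← pow_mul]
      apply pow_dvd_pow
      have := Nat.lt_mul_div_succ NN hw
      omega
    have h4 : (X ^ w) ^ (NN / w + 1) * E' ≡ 0 [MOD X ^ NN] :=
      (Nat.modEq_zero_iff_dvd).mpr (hd.mul_right _)
    have := h4.add_left (E * G w)
    simpa [G] using this
  · have : 1 < X ^ w := Nat.one_lt_pow (by omega) (by norm_num [X])
    omega

def prodG (ws : List ℕ) : ℕ := ws.foldr (fun w A => A * G w % X ^ NN) 1

theorem enc_prodG (ws : List ℕ) (h : ∀ w ∈ ws, w ∣ 840) :
    enc NN (d ws) ≡ prodG ws [MOD X ^ NN] := by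
  induction ws with
  | nil =>
    have : enc NN (d []) = 1 := by
      unfold enc
      rw [Finset.sum_eq_single 0]
      · simp [d]
      · intro b _ hb; simp [d, hb]
      · simp [NN]
    rw [this]
    simp only [prodG, List.foldr_nil]
    exact Nat.ModEq.refl _
  | cons w ws ih =>
    have ih := ih (fun y hy => h y (by simp [hy]))
    have hw : 0 < w := Nat.pos_of_dvd_of_pos (h w (by simp)) (by norm_num)
    refine (enc_G w hw ws).trans ?_
    refine (ih.mul_right (G w)).trans ?_
    simp only [prodG, List.foldr_cons]
    exact (Nat.mod_modEq _ _).symm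

theorem d_bound (ws : List ℕ) : ∀ t, d ws t ≤ (t+1) ^ ws.length := by
  induction ws with
  | nil => intro t; simp [d]; split <;> simp
  | cons w ws ih =>
    intro t
    induction t using Nat.strong_induction_on with
    | _ t iht =>
      rw [d]
      split
      · rename_i h
        have h1 := iht (t - w) (by omega)
        have h2 := ih (t - w)
        have h3 : t - w + 2 ≤ t + 1 := by omega
        simp only [List.length_cons] at *
        calc _ ≤ (t - w + 1) ^ (ws.length + 1) + (t - w + 1) ^ ws.length := add_le_add h1 h2
          _ = (t - w + 1) ^ ws.length * (t - w + 2) := by ring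
          _ ≤ (t + 1) ^ ws.length * (t + 1) := by gcongr; omega
          _ = _ := by ring
      · exact Nat.zero_le _

theorem enc_lt (f : ℕ → ℕ) (k : ℕ) (h : ∀ t < k, f t < X) : enc k f < X ^ k := by
  induction k with
  | zero => simp [enc]
  | succ k ih =>
    have ih := ih (fun t ht => h t (by omega))
    have h1 := h k (by omega)
    have : enc (k+1) f = enc k f + f k * X ^ k := by simp [enc, Finset.sum_range_succ]
    rw [this, pow_succ]
    have : (f k + 1) * X ^ k ≤ X * X ^ k := by gcongr; omega
    nlinarith

theorem enc_digit (f : ℕ → ℕ) (N k : ℕ) (hk : k < N) (h : ∀ t < N, f t < X) :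
    enc N f / X ^ k % X = f k := by
  obtain ⟨r, rfl⟩ := Nat.exists_eq_add_of_lt hk
  have hX : 0 < X := by norm_num [X]
  have h1 : enc (k + r + 1) f = enc k f + X ^ k * (f k + X * ∑ t ∈ Finset.range r, f (k + 1 + t) * X ^ t) := by
    unfold enc
    rw [show k + r + 1 = k + 1 + r by ring, Finset.sum_range_add, Finset.sum_range_succ, mul_add,
      add_assoc, Finset.mul_sum, Finset.mul_sum]
    congr 2
    · ring
    · refine Finset.sum_congr rfl fun t _ => ?_
      rw [pow_add, pow_add]; ring
  have h2 := enc_lt f k (fun t ht => h t (by omega))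
  rw [h1, Nat.add_mul_div_left _ _ (by positivity), Nat.div_eq_of_lt h2, zero_add,
    Nat.add_mul_mod_self_left, Nat.mod_eq_of_lt (h k (by omega))]

def tot (R : List (ℕ × List ℕ)) (t : ℕ) : ℕ := (R.map fun p => p.1 * d p.2 t).sum

def totG (R : List (ℕ × List ℕ)) : ℕ := (R.map fun p => p.1 * prodG p.2).sum

def okR (R : List (ℕ × List ℕ)) : Prop := ∀ p ∈ R, p.2.length ≤ 5 ∧ ∀ w ∈ p.2, w ∣ 840

theorem Q_tot (R : List (ℕ × List ℕ)) (h : okR R) : Q 5 (fun t => (tot R t : ℤ)) := by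
  induction R with
  | nil => simpa [tot] using Q_zero 5
  | cons p R ih =>
    have ih := ih (fun y hy => h y (by simp [hy]))
    obtain ⟨h1, h2⟩ := h p (by simp)
    have := Q_add 5 _ _ (Q_mul 5 p.1 _ (Q_le h1 _ (Q_d p.2 h2))) ih
    simpa [tot] using this

theorem enc_tot (R : List (ℕ × List ℕ)) (h : okR R) : enc NN (tot R) ≡ totG R [MOD X ^ NN] := by
  induction R with
  | nil =>
    simp only [tot, totG, enc, List.map_nil, List.sum_nil, zero_mul, Finset.sum_const_zero]
    exact Nat.ModEq.refl _
  | cons p R ih =>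
    have ih := ih (fun y hy => h y (by simp [hy]))
    obtain ⟨h1, h2⟩ := h p (by simp)
    have := ((enc_prodG p.2 h2).mul_left p.1).add ih
    have e : enc NN (tot (p :: R)) = p.1 * enc NN (d p.2) + enc NN (tot R) := by
      simp only [enc, tot, List.map_cons, List.sum_cons, Finset.mul_sum]
      rw [← Finset.sum_add_distrib]
      refine Finset.sum_congr rfl fun t _ => ?_
      ring
    rw [e]
    simpa [totG] using this

theorem tot_bound (R : List (ℕ × List ℕ)) (h : okR R) (t : ℕ) (ht : t < NN) :
    tot R t ≤ (R.map Prod.fst).sum * NN ^ 5 := by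
  induction R with
  | nil => simp [tot]
  | cons p R ih =>
    have ih := ih (fun y hy => h y (by simp [hy]))
    obtain ⟨h1, h2⟩ := h p (by simp)
    have h3 : d p.2 t ≤ NN ^ 5 := (d_bound p.2 t).trans
      ((Nat.pow_le_pow_left (by omega) _).trans (Nat.pow_le_pow_right (by norm_num [NN]) h1))
    simp only [tot, List.map_cons, List.sum_cons] at *
    rw [add_mul]
    gcongr

theorem tot_eval (R : List (ℕ × List ℕ)) (h : okR R) (hb : (R.map Prod.fst).sum * NN ^ 5 < X)
    (t : ℕ) (ht : t < NN) : tot R t = totG R % X ^ NN / X ^ t % X := by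
  have hb' : ∀ t < NN, tot R t < X := fun t ht => (tot_bound R h t ht).trans_lt hb
  rw [← enc_tot R h, Nat.mod_eq_of_lt (enc_lt _ _ hb'), enc_digit _ _ _ ht hb']

/-! subdivision trees -/

abbrev V := ℕ × ℕ × ℕ × ℕ × ℕ

def cA : V := (1,0,0,0,0)
def cB : V := (0,1,0,0,0)
def cD : V := (0,0,1,0,0)
def cF : V := (0,0,0,1,0)
def cC : V := (0,0,0,0,1)

def pA : V →+ ℕ := ⟨⟨fun m => m.1, rfl⟩, fun _ _ => rfl⟩
def pB : V →+ ℕ := ⟨⟨fun m => m.2.1, rfl⟩, fun _ _ => rfl⟩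
def pD : V →+ ℕ := ⟨⟨fun m => m.2.2.1, rfl⟩, fun _ _ => rfl⟩
def pF : V →+ ℕ := ⟨⟨fun m => m.2.2.2.1, rfl⟩, fun _ _ => rfl⟩
def pAB : V →+ ℕ := ⟨⟨fun m => m.1 + m.2.1, rfl⟩, fun x y => by simp; ring⟩
def pDF : V →+ ℕ := ⟨⟨fun m => m.2.2.1 + m.2.2.2.1, rfl⟩, fun x y => by simp; ring⟩
def W : V →+ ℕ := ⟨⟨fun m => 2 * m.1 + m.2.1 + 2 * m.2.2.1 + m.2.2.2.1 + 3 * m.2.2.2.2, rfl⟩,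
  fun x y => by simp; ring⟩

def forms : List ((V →+ ℕ) × (V →+ ℕ)) :=
  [(pA, pD), (pA, pF), (pA, pDF), (pB, pD), (pB, pF), (pB, pDF), (pAB, pD), (pAB, pF), (pAB, pDF)]

def good (m : V) : Prop := ∀ p ∈ forms, p.1 m ≠ p.2 m

open Classical in
noncomputable def phi (t : ℕ) (m : V) : ℝ≥0∞ := if good m ∧ W m = t then 1 else 0

def leafok (L : List V) : Bool :=
  L.all (fun x => decide (W x ∣ 840)) && decide (L.length ≤ 5) &&
  forms.all fun p => (L.all (fun x => decide (p.1 x ≤ p.2 x)) && L.any (fun x => decide (p.1 x < p.2 x)))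
    || (L.all (fun x => decide (p.2 x ≤ p.1 x)) && L.any (fun x => decide (p.2 x < p.1 x)))

def zerook (L : List V) : Bool :=
  forms.any fun p => L.all (fun x => decide (p.1 x = p.2 x))

inductive Tr
  | z | l
  | s (i j : ℕ) (p q r : Tr)

def mv (k : ℕ) (L : List V) : List V :=
  match L[k]? with
  | some x => x :: L.eraseIdx k
  | none => L

theorem mv_perm (k : ℕ) (L : List V) : L.Perm (mv k L) := by
  unfold mv
  split
  · rename_i x h
    obtain ⟨hk, rfl⟩ := List.getElem?_eq_some_iff.mp h
    exact (List.getElem_cons_eraseIdx_perm hk).symm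
  · exact List.Perm.refl _

/-- leaves of a subdivision tree; `none` if the tree is not valid -/
def leaves : Tr → List V → Option (List (List ℕ))
  | .z, L => if zerook L then some [] else none
  | .l, L => if leafok L then some [L.map W] else none
  | .s i j p q r, L =>
    match mv (i+1) (mv j L) with
    | x :: y :: R =>
      match leaves p (x :: (x+y) :: R), leaves q ((x+y) :: R), leaves r (y :: (x+y) :: R) with
      | some a, some b, some c => some (a ++ b ++ c)
      | _, _, _ => none
    | _ => none

theorem leaf_S (L : List V) (h : leafok L = true) (t : ℕ) :
    S L (phi t) = (d (L.map W) t : ℝ≥0∞) := by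
  simp only [leafok, Bool.and_eq_true, List.all_eq_true, decide_eq_true_eq, Bool.or_eq_true,
    List.any_eq_true] at h
  obtain ⟨⟨h1, h2⟩, h3⟩ := h
  rw [← S_eq_d, ← S_map]
  · refine S_congr L _ _ fun m hm => ?_
    have hg : good m := by
      intro p hp
      rcases h3 p hp with ⟨h4, h5⟩ | ⟨h4, h5⟩
      · exact (Pos_lt _ _ L h4 h5 m hm).ne
      · exact (Pos_lt _ _ L h4 h5 m hm).ne'
    simp [phi, hg]
  · intro w hw
    obtain ⟨x, hx, rfl⟩ := List.mem_map.mp hw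
    exact Nat.pos_of_dvd_of_pos (h1 x hx) (by norm_num)

theorem zero_S (L : List V) (h : zerook L = true) (t : ℕ) : S L (phi t) = 0 := by
  simp only [zerook, List.any_eq_true, List.all_eq_true, decide_eq_true_eq] at h
  obtain ⟨p, hp, h⟩ := h
  rw [← S_zero L]
  refine S_congr L _ _ fun m hm => ?_
  have hg : ¬ good m := fun hg => hg p hp
    (le_antisymm (Pos_le _ _ L (fun x hx => (h x hx).le) m hm)
      (Pos_le _ _ L (fun x hx => (h x hx).ge) m hm))
  simp [phi, hg]

theorem leaves_ok (T : Tr) : ∀ (L : List V) (R : List (List ℕ)), leaves T L = some R →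
    (∀ ws ∈ R, ws.length ≤ 5 ∧ ∀ w ∈ ws, w ∣ 840) ∧
    ∀ t, S L (phi t) = (((R.map fun ws => d ws t).sum : ℕ) : ℝ≥0∞) := by
  induction T with
  | z =>
    intro L R h
    simp only [leaves] at h
    split at h
    · rename_i hz
      obtain rfl := Option.some.inj h
      exact ⟨by simp, fun t => by simp [zero_S L hz]⟩
    · simp at h
  | l =>
    intro L R h
    simp only [leaves] at h
    split at h
    · rename_i hz
      obtain rfl := Option.some.inj h
      refine ⟨?_, fun t => by simp [leaf_S L hz]⟩
      simp only [leafok, Bool.and_eq_true, List.all_eq_true, decide_eq_true_eq] at hz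
      intro ws hws
      rw [List.mem_singleton] at hws
      subst hws
      refine ⟨by simpa using hz.1.2, fun w hw => ?_⟩
      obtain ⟨x, hx, rfl⟩ := List.mem_map.mp hw
      exact hz.1.1 x hx
    · simp at h
  | s i j p q r ihp ihq ihr =>
    intro L R h
    simp only [leaves] at h
    split at h
    · rename_i x y L' hL
      split at h
      · rename_i a b c ha hb hc
        obtain rfl := Option.some.inj h
        obtain ⟨a1, a2⟩ := ihp _ _ ha
        obtain ⟨b1, b2⟩ := ihq _ _ hb
        obtain ⟨c1, c2⟩ := ihr _ _ hc
        refine ⟨?_, fun t => ?_⟩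
        · intro ws hws
          simp only [List.mem_append] at hws
          rcases hws with (h | h) | h
          · exact a1 _ h
          · exact b1 _ h
          · exact c1 _ h
        · rw [S_perm ((mv_perm j L).trans (mv_perm (i+1) _)), hL, S_split, a2, b2, c2]
          simp [add_assoc]
      · simp at h
    · simp at h

open Tr in
def roots : List (ℕ × List V × Tr) :=
  [
  (36, [cA, cB, cD, cF, cC], (s 0 2 (s 2 3 (s 0 3 (s 2 3 (s 0 3 l z l) z l) z (s 2 3 (s 0 2 (s 0 3 l z l) l (s 0 2 l z l)) z (s 1 2 l z l))) z (s 1 3 (s 2 3 (s 0 3 l z l) z (s 0 2 (s 0 3 l z l) z l)) z (s 2 3 (s 0 2 (s 0 3 l z l) z l) z (s 0 3 l z l)))) z (s 2 3 (s 1 3 (s 2 3 (s 0 3 l z l) z (s 0 2 (s 0 3 l z l) z l)) z (s 2 3 (s 0 2 (s 0 3 l z l) z l) z (s 0 3 l z l))) z (s 1 2 (s 0 3 (s 1 3 l z l) z (s 0 3 (s 0 3 l z l) l (s 0 2 l z l))) z (s 2 3 l z (s 0 3 l z l)))))),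
  (18, [cA, cB, cD, cC], (s 1 2 (s 1 2 l z l) z (s 0 2 l z (s 0 2 l z l)))),
  (18, [cA, cB, cF, cC], (s 1 2 (s 1 2 l z l) z (s 0 2 l z (s 0 2 l z l)))),
  (6, [cA, cB, cC], l),
  (18, [cA, cD, cF, cC], (s 0 2 (s 0 2 l z (s 0 2 l z l)) z (s 1 2 l z l))),
  (9, [cA, cD, cC], z),
  (9, [cA, cF, cC], z),
  (3, [cA, cC], z),
  (18, [cB, cD, cF, cC], (s 0 2 (s 0 2 l z (s 0 2 l z l)) z (s 1 2 l z l))),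
  (9, [cB, cD, cC], z),
  (9, [cB, cF, cC], z),
  (3, [cB, cC], z),
  (6, [cD, cF, cC], l),
  (3, [cD, cC], z),
  (3, [cF, cC], z),
  (1, [cC], z)]

def leavesAll : List (ℕ × List V × Tr) → Option (List (ℕ × List ℕ))
  | [] => some []
  | (m, L, T) :: R =>
    match leaves T L, leavesAll R with
    | some a, some b => some (a.map (fun ws => (m, ws)) ++ b)
    | _, _ => none

noncomputable def SAll (R : List (ℕ × List V × Tr)) (t : ℕ) : ℝ≥0∞ :=
  (R.map fun p => (p.1 : ℝ≥0∞) * S p.2.1 (phi t)).sum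

theorem leavesAll_ok (A : List (ℕ × List V × Tr)) : ∀ R, leavesAll A = some R →
    okR R ∧ ∀ t, SAll A t = (tot R t : ℝ≥0∞) := by
  induction A with
  | nil =>
    intro R h
    obtain rfl := Option.some.inj h
    exact ⟨by simp [okR], fun t => by simp [SAll, tot]⟩
  | cons p A ih =>
    obtain ⟨m, L, T⟩ := p
    intro R h
    simp only [leavesAll] at h
    split at h
    · rename_i a b ha hb
      obtain rfl := Option.some.inj h
      obtain ⟨h1, h2⟩ := leaves_ok _ _ _ ha
      obtain ⟨h3, h4⟩ := ih _ hb
      refine ⟨?_, fun t => ?_⟩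
      · intro q hq
        rcases List.mem_append.mp hq with hq | hq
        · obtain ⟨ws, hws, rfl⟩ := List.mem_map.mp hq
          exact h1 ws hws
        · exact h3 q hq
      · have h4 := h4 t
        simp only [SAll, tot, List.map_cons, List.sum_cons, List.map_append, List.sum_append] at *
        rw [h2, h4, List.map_map, Nat.cast_add]
        congr 1
        rw [← Nat.cast_mul, ← List.sum_map_mul_left]
        rfl
    · simp at h

def RR : List (ℕ × List ℕ) := (leavesAll roots).getD []

theorem RR_some : leavesAll roots = some RR := by
  have : (leavesAll roots).isSome = true := by decide +kernel
  obtain ⟨a, ha⟩ := Option.isSome_iff_exists.mp this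
  simp [RR, ha]

theorem RR_bound : (RR.map Prod.fst).sum * NN ^ 5 < X := by decide +kernel

def vals : List ℕ := let P := totG RR % X ^ NN
  [P / X ^ 840 % X, P / X ^ 1680 % X, P / X ^ 2520 % X, P / X ^ 3360 % X, P / X ^ 4200 % X]

theorem vals_eq : vals = [60482224740, 981623929332, 4993177562724, 15818509652916, 38674600807908] := by
  decide +kernel

theorem tot_poly (k : ℕ) : 280 * (tot RR (840 * (k+1)) : ℤ) =
    35*(840 * (k+1) : ℤ)^4 - 840*(840 * (k+1) : ℤ)^3 + 10570*(840 * (k+1) : ℤ)^2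
        - 73536*(840 * (k+1) : ℤ) + 265440 := by
  have hok := (leavesAll_ok _ _ RR_some).1
  have hQ := Q_tot RR hok
  simp only [Q] at hQ
  have hv := vals_eq
  simp only [vals, List.cons.injEq, and_true] at hv
  obtain ⟨v1, v2, v3, v4, v5⟩ := hv
  rw [← tot_eval RR hok RR_bound _ (by norm_num [NN])] at v1 v2 v3 v4 v5
  induction k using Nat.strong_induction_on with
  | _ k ih =>
    rcases lt_or_ge k 5 with hk | hk
    · interval_cases k
      · norm_num [v1]
      · norm_num [v2]
      · norm_num [v3]
      · norm_num [v4]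
      · norm_num [v5]
    · obtain ⟨j, rfl⟩ := Nat.exists_eq_add_of_le' hk
      have i0 := ih j (by omega)
      have i1 := ih (j+1) (by omega)
      have i2 := ih (j+2) (by omega)
      have i3 := ih (j+3) (by omega)
      have i4 := ih (j+4) (by omega)
      have q := hQ (840 * (j+1)) (by omega)
      simp only [show 840 * (j + 1) + 840 = 840 * (j+1+1) by ring,
        show 840 * (j + 1 + 1) + 840 = 840 * (j+2+1) by ring,
        show 840 * (j + 2 + 1) + 840 = 840 * (j+3+1) by ring,
        show 840 * (j + 3 + 1) + 840 = 840 * (j+4+1) by ring,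
        show 840 * (j + 4 + 1) + 840 = 840 * (j+5+1) by ring] at q
      push_cast at i0 i1 i2 i3 i4 ⊢
      linear_combination 280 * q + 5 * i4 - 10 * i3 + 10 * i2 - 5 * i1 + i0

end Magi

namespace Magi

theorem tsum_min (ψ : ℕ → ℕ → ℕ → ℝ≥0∞) (h12 : ∀ x y z, ψ x y z = ψ y x z)
    (h23 : ∀ x y z, ψ x y z = ψ x z y) :
    ∑' x, ∑' y, ∑' z, (if x = 0 ∨ y = 0 ∨ z = 0 then ψ x y z else 0) =
      6 * ∑' n, ∑' m, ψ 0 (n+1) (n+1+(m+1)) + 3 * ∑' n, ψ 0 (n+1) (n+1)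
        + 3 * ∑' n, ψ 0 0 (n+1) + ψ 0 0 0 := by
  have z : ∀ f : ℕ → ℝ≥0∞, ∑' n, f n = f 0 + ∑' n, f (n+1) :=
    fun f => tsum_eq_zero_add' ENNReal.summable
  have h3 : ∑' n, ∑' m, ψ 0 (n+1) (m+1) =
      2 * ∑' n, ∑' m, ψ 0 (n+1) (n+1+(m+1)) + ∑' n, ψ 0 (n+1) (n+1) := by
    rw [tsum_split (fun n m => ψ 0 (n+1) (m+1))]
    have e1 : ∑' k, ∑' m, ψ 0 (k+1+m+1) (m+1) = ∑' n, ∑' m, ψ 0 (n+1) (n+1+(m+1)) := by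
      rw [ENNReal.tsum_comm]
      refine tsum_congr fun n => tsum_congr fun m => ?_
      rw [h23]; congr 1; ring
    have e2 : ∑' k, ∑' m, ψ 0 (m+1) (k+1+m+1) = ∑' n, ∑' m, ψ 0 (n+1) (n+1+(m+1)) := by
      rw [ENNReal.tsum_comm]
      refine tsum_congr fun n => tsum_congr fun m => ?_
      congr 1; ring
    rw [e1, e2]; ring
  have inner2 : ∀ h : ℕ → ℕ → ℝ≥0∞, ∑' y, ∑' z, h y z = (h 0 0 + ∑' z, h 0 (z+1))
      + (∑' y, h (y+1) 0 + ∑' y, ∑' z, h (y+1) (z+1)) := by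
    intro h
    rw [z, z (h 0), ← ENNReal.tsum_add]
    congr 1
    exact tsum_congr fun y => z _
  have inner3 : ∀ g : ℕ → ℕ → ℕ → ℝ≥0∞, ∑' x, ∑' y, ∑' z, g x y z =
      ((g 0 0 0 + ∑' z, g 0 0 (z+1)) + (∑' y, g 0 (y+1) 0 + ∑' y, ∑' z, g 0 (y+1) (z+1)))
      + ∑' x, ((g (x+1) 0 0 + ∑' z, g (x+1) 0 (z+1))
        + (∑' y, g (x+1) (y+1) 0 + ∑' y, ∑' z, g (x+1) (y+1) (z+1))) := by
    intro g
    rw [z, inner2]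
    congr 1
    exact tsum_congr fun x => inner2 _
  rw [inner3]
  simp only [true_or, or_true, if_true, Nat.add_eq_zero_iff, one_ne_zero, and_false, false_or,
    or_false, if_false, tsum_zero, add_zero, ENNReal.tsum_add]
  have e1 : ∑' n, ψ 0 (n+1) 0 = ∑' n, ψ 0 0 (n+1) := tsum_congr fun n => h23 _ _ _
  have e2 : ∑' n, ψ (n+1) 0 0 = ∑' n, ψ 0 0 (n+1) := tsum_congr fun n => by rw [h12, h23]
  have e3 : ∑' n, ∑' m, ψ (n+1) 0 (m+1) = ∑' n, ∑' m, ψ 0 (n+1) (m+1) :=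
    tsum_congr fun n => tsum_congr fun m => h12 _ _ _
  have e4 : ∑' n, ∑' m, ψ (n+1) (m+1) 0 = ∑' n, ∑' m, ψ 0 (n+1) (m+1) :=
    tsum_congr fun n => tsum_congr fun m => by rw [h23, h12]
  rw [e1, e2, e3, e4, h3]
  ring

def gd (e f : Fin 3 → ℕ) : Prop := ∀ p p' q q', p ≠ p' → q ≠ q' → e p + f q ≠ e p' + f q'

theorem gd_perm_left (e f : Fin 3 → ℕ) (σ : Equiv.Perm (Fin 3)) (h : gd e f) : gd (e ∘ σ) f :=
  fun p p' q q' hp hq => h (σ p) (σ p') q q' (σ.injective.ne hp) hq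

theorem gd_perm_right (e f : Fin 3 → ℕ) (σ : Equiv.Perm (Fin 3)) (h : gd e f) : gd e (f ∘ σ) :=
  fun p p' q q' hp hq => h p p' (σ q) (σ q') hp (σ.injective.ne hq)

theorem sw01 (x y z : ℕ) : ![x, y, z] ∘ (Equiv.swap 0 1 : Equiv.Perm (Fin 3)) = ![y, x, z] := by
  funext i; fin_cases i <;> rfl

theorem sw12 (x y z : ℕ) : ![x, y, z] ∘ (Equiv.swap 1 2 : Equiv.Perm (Fin 3)) = ![x, z, y] := by
  funext i; fin_cases i <;> rfl

theorem gd_l1 (x y z : ℕ) (f : Fin 3 → ℕ) : gd ![x, y, z] f ↔ gd ![y, x, z] f :=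
  ⟨fun h => sw01 x y z ▸ gd_perm_left _ _ _ h, fun h => sw01 y x z ▸ gd_perm_left _ _ _ h⟩
theorem gd_l2 (x y z : ℕ) (f : Fin 3 → ℕ) : gd ![x, y, z] f ↔ gd ![x, z, y] f :=
  ⟨fun h => sw12 x y z ▸ gd_perm_left _ _ _ h, fun h => sw12 x z y ▸ gd_perm_left _ _ _ h⟩
theorem gd_r1 (x y z : ℕ) (e : Fin 3 → ℕ) : gd e ![x, y, z] ↔ gd e ![y, x, z] :=
  ⟨fun h => sw01 x y z ▸ gd_perm_right _ _ _ h, fun h => sw01 y x z ▸ gd_perm_right _ _ _ h⟩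
theorem gd_r2 (x y z : ℕ) (e : Fin 3 → ℕ) : gd e ![x, y, z] ↔ gd e ![x, z, y] :=
  ⟨fun h => sw12 x y z ▸ gd_perm_right _ _ _ h, fun h => sw12 x z y ▸ gd_perm_right _ _ _ h⟩

theorem gd_good (a b p q c : ℕ) : gd ![0, a, a+b] ![0, p, p+q] ↔ good (a, b, p, q, c) := by
  constructor
  · intro h
    have h1 := h 1 0 0 1 (by decide) (by decide)
    have h2 := h 1 0 1 2 (by decide) (by decide)
    have h3 := h 1 0 0 2 (by decide) (by decide)
    have h4 := h 2 1 0 1 (by decide) (by decide)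
    have h5 := h 2 1 1 2 (by decide) (by decide)
    have h6 := h 2 1 0 2 (by decide) (by decide)
    have h7 := h 2 0 0 1 (by decide) (by decide)
    have h8 := h 2 0 1 2 (by decide) (by decide)
    have h9 := h 2 0 0 2 (by decide) (by decide)
    simp at h1 h2 h3 h4 h5 h6 h7 h8 h9
    simp only [good, forms, List.forall_mem_cons, pA, pB, pD, pF, pAB, pDF, AddMonoidHom.coe_mk,
      ZeroHom.coe_mk]
    refine ⟨?_, ?_, ?_, ?_, ?_, ?_, ?_, ?_, ?_, by simp⟩ <;> omega
  · intro h
    simp only [good, forms, List.forall_mem_cons, pA, pB, pD, pF, pAB, pDF, AddMonoidHom.coe_mk,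
      ZeroHom.coe_mk] at h
    obtain ⟨h1, h2, h3, h4, h5, h6, h7, h8, h9, -⟩ := h
    intro i i' j j' hi hj
    fin_cases i <;> fin_cases i' <;> first | exact absurd rfl hi | skip
    all_goals (fin_cases j <;> fin_cases j' <;> first | exact absurd rfl hj | skip)
    all_goals simp
    all_goals omega

open Classical in
noncomputable def Phi (t e0 e1 e2 f0 f1 f2 : ℕ) : ℝ≥0∞ :=
  ∑' c : ℕ, if gd ![e0, e1, e2] ![f0, f1, f2] ∧ e0 + e1 + e2 + (f0 + f1 + f2) + 3 * (c + 1) = t then 1 else 0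

theorem Phi_phi (t a b p q : ℕ) : Phi t 0 a (a+b) 0 p (p+q) = ∑' c : ℕ, phi t (a, b, p, q, c+1) := by
  unfold Phi phi
  refine tsum_congr fun c => ?_
  rw [gd_good a b p q (c+1)]
  congr 2
  simp only [W, AddMonoidHom.coe_mk, ZeroHom.coe_mk, eq_iff_iff]
  constructor <;> intro h <;> omega

theorem Phi_l1 (t x y z a b c : ℕ) : Phi t x y z a b c = Phi t y x z a b c := by
  unfold Phi; rw [gd_l1 x y z, add_comm x y]
theorem Phi_l2 (t x y z a b c : ℕ) : Phi t x y z a b c = Phi t x z y a b c := by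
  unfold Phi; rw [gd_l2 x y z, add_right_comm x y z]
theorem Phi_r1 (t x y z a b c : ℕ) : Phi t a b c x y z = Phi t a b c y x z := by
  unfold Phi; rw [gd_r1 x y z, add_comm x y]
theorem Phi_r2 (t x y z a b c : ℕ) : Phi t a b c x y z = Phi t a b c x z y := by
  unfold Phi; rw [gd_r2 x y z, add_right_comm x y z]

theorem total (t : ℕ) :
    ∑' e0, ∑' e1, ∑' e2, (if e0 = 0 ∨ e1 = 0 ∨ e2 = 0 then
      ∑' f0, ∑' f1, ∑' f2, (if f0 = 0 ∨ f1 = 0 ∨ f2 = 0 then Phi t e0 e1 e2 f0 f1 f2 else 0) else 0)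
    = SAll roots t := by
  rw [tsum_min]
  · simp only [fun e0 e1 e2 => tsum_min (fun f0 f1 f2 => Phi t e0 e1 e2 f0 f1 f2)
      (fun x y z => Phi_r1 t x y z _ _ _)
      (fun x y z => Phi_r2 t x y z _ _ _)]
    have e1 : ∀ n p q, Phi t 0 n n 0 p (p+q) = ∑' c : ℕ, phi t (n, 0, p, q, c+1) :=
      fun n p q => Phi_phi t n 0 p q
    have e2 : ∀ n p q, Phi t 0 0 n 0 p (p+q) = ∑' c : ℕ, phi t (0, n, p, q, c+1) :=
      fun n p q => by simpa using Phi_phi t 0 n p q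
    have f1 : ∀ a b p, Phi t 0 a (a+b) 0 p p = ∑' c : ℕ, phi t (a, b, p, 0, c+1) :=
      fun a b p => Phi_phi t a b p 0
    have f2 : ∀ a b p, Phi t 0 a (a+b) 0 0 p = ∑' c : ℕ, phi t (a, b, 0, p, c+1) :=
      fun a b p => by simpa using Phi_phi t a b 0 p
    have f3 : ∀ a b, Phi t 0 a (a+b) 0 0 0 = ∑' c : ℕ, phi t (a, b, 0, 0, c+1) :=
      fun a b => by simpa using Phi_phi t a b 0 0
    have g1 : ∀ a p, Phi t 0 a a 0 p p = ∑' c : ℕ, phi t (a, 0, p, 0, c+1) :=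
      fun a p => f1 a 0 p
    have g2 : ∀ a p, Phi t 0 a a 0 0 p = ∑' c : ℕ, phi t (a, 0, 0, p, c+1) :=
      fun a p => f2 a 0 p
    have g3 : ∀ a, Phi t 0 a a 0 0 0 = ∑' c : ℕ, phi t (a, 0, 0, 0, c+1) :=
      fun a => f3 a 0
    have k1 : ∀ a p, Phi t 0 0 a 0 p p = ∑' c : ℕ, phi t (0, a, p, 0, c+1) :=
      fun a p => by simpa using f1 0 a p
    have k2 : ∀ a p, Phi t 0 0 a 0 0 p = ∑' c : ℕ, phi t (0, a, 0, p, c+1) :=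
      fun a p => by simpa using f2 0 a p
    have k3 : ∀ a, Phi t 0 0 a 0 0 0 = ∑' c : ℕ, phi t (0, a, 0, 0, c+1) :=
      fun a => by simpa using f3 0 a
    simp only [Phi_phi, e1, e2, f1, f2, f3, g1, g2, g3, k1, k2, k3]
    simp only [SAll, roots, List.map_cons, List.map_nil, List.sum_cons, List.sum_nil, S]
    simp [cA, cB, cD, cF, cC]
    simp only [ENNReal.tsum_add, ENNReal.tsum_mul_left]
    ring
  · intro x y z
    simp only [Phi_l1 t x y z]
  · intro x y z
    simp only [Phi_l2 t x y z]

end Magi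

namespace Magi

def Kp (t : ℕ) (k : ℕ × ℕ × ℕ × ℕ × ℕ × ℕ × ℕ) : Prop :=
  (k.1 = 0 ∨ k.2.1 = 0 ∨ k.2.2.1 = 0) ∧ (k.2.2.2.1 = 0 ∨ k.2.2.2.2.1 = 0 ∨ k.2.2.2.2.2.1 = 0) ∧
  gd ![k.1, k.2.1, k.2.2.1] ![k.2.2.2.1, k.2.2.2.2.1, k.2.2.2.2.2.1] ∧
  k.1 + k.2.1 + k.2.2.1 + (k.2.2.2.1 + k.2.2.2.2.1 + k.2.2.2.2.2.1) + 3 * (k.2.2.2.2.2.2 + 1) = t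

def mk (e f : Fin 3 → ℕ) (c : ℕ) : Matrix (Fin 3) (Fin 3) ℤ :=
  fun i j => ((e (i + j) + f (i - j) + (c + 1) : ℕ) : ℤ)

def FF (k : ℕ × ℕ × ℕ × ℕ × ℕ × ℕ × ℕ) : Matrix (Fin 3) (Fin 3) ℤ :=
  mk ![k.1, k.2.1, k.2.2.1] ![k.2.2.2.1, k.2.2.2.2.1, k.2.2.2.2.2.1] k.2.2.2.2.2.2

def MS (t : ℕ) : Set (Matrix (Fin 3) (Fin 3) ℤ) :=
  {x : Matrix (Fin 3) (Fin 3) ℤ |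
    (∀ i j, 0 < x i j) ∧
    (∀ i, Function.Injective fun j => x i j) ∧
    (∀ j, Function.Injective fun i => x i j) ∧
    (∀ i, ∑ j, x i j = (t : ℤ)) ∧ (∀ j, ∑ i, x i j = (t : ℤ))}

theorem gd_iff (e f : Fin 3 → ℕ) (c : ℕ) : gd e f ↔
    (∀ i, Function.Injective fun j => mk e f c i j) ∧
    (∀ j, Function.Injective fun i => mk e f c i j) := by
  constructor
  · intro h
    constructor
    · intro i j k hjk
      by_contra hne
      refine h (i+j) (i+k) (i-j) (i-k) (by simpa using hne) (by simpa using hne) ?_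
      simp only [mk, Nat.cast_inj] at hjk
      omega
    · intro i j k hjk
      by_contra hne
      refine h (j+i) (k+i) (j-i) (k-i) (by simpa using hne) (by simpa using hne) ?_
      simp only [mk, Nat.cast_inj] at hjk
      omega
  · rintro ⟨h1, h2⟩ p p' q q' hp hq heq
    have key : ∀ p p' q q' : Fin 3, p ≠ p' → q ≠ q' →
      (∃ i j k, j ≠ k ∧ i + j = p ∧ i - j = q ∧ i + k = p' ∧ i - k = q') ∨
      (∃ i j k, j ≠ k ∧ j + i = p ∧ j - i = q ∧ k + i = p' ∧ k - i = q') := by decide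
    rcases key p p' q q' hp hq with ⟨i, j, k, hne, rfl, rfl, rfl, rfl⟩ | ⟨i, j, k, hne, rfl, rfl, rfl, rfl⟩
    · exact hne (h1 i (by simp only [mk, heq]))
    · exact hne (h2 i (by simp only [mk, heq]))

theorem mk_eq (e0 e1 e2 f0 f1 f2 c : ℕ) : mk ![e0, e1, e2] ![f0, f1, f2] c =
    !![(e0 + f0 + (c+1) : ℤ), e1 + f2 + (c+1), e2 + f1 + (c+1);
       e1 + f1 + (c+1), e2 + f0 + (c+1), e0 + f2 + (c+1);
       e2 + f2 + (c+1), e0 + f1 + (c+1), e1 + f0 + (c+1)] := by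
  ext i j
  fin_cases i <;> fin_cases j <;> simp [mk] <;> rfl

theorem injOn (t : ℕ) : Set.InjOn FF {k | Kp t k} := by
  rintro ⟨e0, e1, e2, f0, f1, f2, c⟩ ⟨h1, h2, -, -⟩ ⟨e0', e1', e2', f0', f1', f2', c'⟩
    ⟨h1', h2', -, -⟩ h
  simp only [FF, mk_eq] at h h1 h2 h1' h2'
  have a00 := congrFun (congrFun h 0) 0
  have a01 := congrFun (congrFun h 0) 1
  have a02 := congrFun (congrFun h 0) 2
  have a10 := congrFun (congrFun h 1) 0
  have a11 := congrFun (congrFun h 1) 1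
  have a12 := congrFun (congrFun h 1) 2
  have a20 := congrFun (congrFun h 2) 0
  have a21 := congrFun (congrFun h 2) 1
  have a22 := congrFun (congrFun h 2) 2
  simp at a00 a01 a02 a10 a11 a12 a20 a21 a22
  have hc : c = c' := by
    rcases h1 with h1 | h1 | h1 <;> rcases h2 with h2 | h2 | h2 <;>
    rcases h1' with h1' | h1' | h1' <;> rcases h2' with h2' | h2' | h2' <;> omega
  have he : e0 = e0' := by
    rcases h1 with h1 | h1 | h1 <;> rcases h1' with h1' | h1' | h1' <;> omega
  simp only [Prod.mk.injEq]
  refine ⟨?_, ?_, ?_, ?_, ?_, ?_, ?_⟩ <;> omega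

theorem exists_min (a b c : ℤ) : ∃ m, m ≤ a ∧ m ≤ b ∧ m ≤ c ∧ (m = a ∨ m = b ∨ m = c) :=
  ⟨min a (min b c), by omega, by omega, by omega, by omega⟩

theorem image (t : ℕ) : FF '' {k | Kp t k} = MS t := by
  ext x
  constructor
  · rintro ⟨⟨e0, e1, e2, f0, f1, f2, c⟩, ⟨-, -, h3, h4⟩, rfl⟩
    simp only at h3 h4
    have h5 := (gd_iff _ _ c).mp h3
    refine ⟨?_, h5.1, h5.2, ?_, ?_⟩
    · intro i j
      simp only [FF, mk]
      positivity
    · simp only [FF, mk_eq]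
      intro i
      fin_cases i <;> simp [Fin.sum_univ_three] <;> omega
    · simp only [FF, mk_eq]
      intro i
      fin_cases i <;> simp [Fin.sum_univ_three] <;> omega
  · rintro ⟨h1, h2, h3, h4, h5⟩
    have r0 := h4 0
    have r1 := h4 1
    have r2 := h4 2
    have c0 := h5 0
    have c1 := h5 1
    have c2 := h5 2
    simp only [Fin.sum_univ_three] at r0 r1 r2 c0 c1 c2
    have p00 := h1 0 0
    have p01 := h1 0 1
    have p02 := h1 0 2
    have p10 := h1 1 0
    have p11 := h1 1 1
    have p12 := h1 1 2
    have p20 := h1 2 0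
    have p21 := h1 2 1
    have p22 := h1 2 2
    obtain ⟨m, m1, m2, m3, m4⟩ := exists_min (x 0 0) (x 2 2) (x 1 1)
    obtain ⟨n, n1, n2, n3, n4⟩ := exists_min (x 0 0) (x 2 1) (x 1 2)
    have hc : 0 ≤ m + n - x 0 0 - 1 := by
      rcases m4 with m4 | m4 | m4 <;> rcases n4 with n4 | n4 | n4 <;> omega
    obtain ⟨e0, he0⟩ := Int.eq_ofNat_of_zero_le (sub_nonneg.mpr m1)
    obtain ⟨e1, he1⟩ := Int.eq_ofNat_of_zero_le (sub_nonneg.mpr m2)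
    obtain ⟨e2, he2⟩ := Int.eq_ofNat_of_zero_le (sub_nonneg.mpr m3)
    obtain ⟨f0, hf0⟩ := Int.eq_ofNat_of_zero_le (sub_nonneg.mpr n1)
    obtain ⟨f1, hf1⟩ := Int.eq_ofNat_of_zero_le (sub_nonneg.mpr n2)
    obtain ⟨f2, hf2⟩ := Int.eq_ofNat_of_zero_le (sub_nonneg.mpr n3)
    obtain ⟨c, hc⟩ := Int.eq_ofNat_of_zero_le hc
    have hx : x = mk ![e0, e1, e2] ![f0, f1, f2] c := by
      rw [mk_eq]
      ext i j
      fin_cases i <;> fin_cases j <;> simp <;> omega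
    refine ⟨(e0, e1, e2, f0, f1, f2, c), ⟨?_, ?_, ?_, ?_⟩, hx.symm⟩
    · simp only; omega
    · simp only; omega
    · rw [hx] at h2 h3
      exact (gd_iff _ _ c).mpr ⟨h2, h3⟩
    · simp only; omega

theorem encard_MS (t : ℕ) : ((MS t).encard : ℝ≥0∞) = SAll roots t := by
  classical
  rw [← image, (injOn t).encard_image, ← total, ← ENNReal.tsum_set_one, tsum_subtype {k | Kp t k} (fun _ => (1 : ℝ≥0∞))]
  simp only [ENNReal.tsum_prod']
  refine tsum_congr fun e0 => tsum_congr fun e1 => tsum_congr fun e2 => ?_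
  split_ifs with h
  · refine tsum_congr fun f0 => tsum_congr fun f1 => tsum_congr fun f2 => ?_
    split_ifs with h'
    · unfold Phi
      refine tsum_congr fun c => ?_
      simp only [Set.indicator_apply, Set.mem_setOf_eq, Kp, h, h', true_and]
    · simp [Set.indicator_apply, Kp, h']
  · simp [Set.indicator_apply, Kp, h]

theorem La_tot (t : ℕ) : La t = tot RR t := by
  have h := encard_MS t
  rw [(leavesAll_ok _ _ RR_some).2 t] at h
  have h' : (MS t).encard = (tot RR t : ℕ∞) := by exact_mod_cast h
  show (MS t).ncard = _
  rw [Set.ncard, h']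
  rfl

end Magi

theorem magilatin_affine_principal (t : ℕ) (ht : 0 < t) (hdvd : 840 ∣ t) :
    280 * (La t : ℤ) =
      35*(t : ℤ)^4 - 840*(t : ℤ)^3 + 10570*(t : ℤ)^2
        - 73536*(t : ℤ) + 265440 := by
  obtain ⟨k, rfl⟩ := hdvd
  obtain ⟨j, rfl⟩ : ∃ j, k = j + 1 := ⟨k - 1, by omega⟩
  rw [Magi.La_tot]
  have := Magi.tot_poly j
  push_cast
  exact this
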